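/- Fix M, N > 0 and set 𝒟_n = (1 + M K_{n−1}(−1,−1))(1 + N K_{n−1}^{(1,1)}(−1,−1)) − M N (K_{n−1}^{(1,0)}(−1,−1))². Then lim_{n→∞} 𝒟_n / n^{4β+8} = M N / (2^{2α+2β+4} (β+1) (β+2)² (β+3) (Γ(β+1))² (Γ(β+2))²). -/

import Mathlib

open MeasureTheory Polynomial Filter

theorem Real.Gamma_add_natCast {x : ℝ} (hx : 0 < x) (k : ℕ) :
    Real.Gamma (x + k) = (ascPochhammer ℝ k).eval x * Real.Gamma x := by
  induction k with
  | zero => simp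
  | succ k ih =>
    have hk : x + k ≠ 0 := by positivity
    rw [ascPochhammer_succ_eval, Nat.cast_succ, ← add_assoc, Real.Gamma_add_one hk, ih]
    ring

theorem Real.ascPochhammer_succ_eval_left (k : ℕ) (x : ℝ) :
    (ascPochhammer ℝ (k + 1)).eval x = x * (ascPochhammer ℝ k).eval (x + 1) := by
  simp [ascPochhammer_succ_left, eval_comp]

/-- The Chu–Vandermonde identity. -/
theorem sum_choose_mul_ascPochhammer_div (n : ℕ) (b c : ℝ) (hc : 0 < c) :
    ∑ k ∈ Finset.range (n + 1), (-1 : ℝ) ^ k * n.choose k *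
        ((ascPochhammer ℝ k).eval b / (ascPochhammer ℝ k).eval c)
      = (ascPochhammer ℝ n).eval (c - b) / (ascPochhammer ℝ n).eval c := by
  induction n generalizing b c with
  | zero => simp
  | succ n ih =>
    have hstep : ∑ k ∈ Finset.range (n + 1 + 1), (-1 : ℝ) ^ k * (n + 1).choose k *
        ((ascPochhammer ℝ k).eval b / (ascPochhammer ℝ k).eval c)
        = ∑ k ∈ Finset.range (n + 1), (-1 : ℝ) ^ k * n.choose k *
            ((ascPochhammer ℝ k).eval b / (ascPochhammer ℝ k).eval c)
          - b / c * ∑ k ∈ Finset.range (n + 1), (-1 : ℝ) ^ k * n.choose k *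
            ((ascPochhammer ℝ k).eval (b + 1) / (ascPochhammer ℝ k).eval (c + 1)) := by
      have hlast : ∑ k ∈ Finset.range (n + 1), (-1 : ℝ) ^ k * n.choose k *
            ((ascPochhammer ℝ k).eval b / (ascPochhammer ℝ k).eval c)
          = ∑ k ∈ Finset.range (n + 1 + 1), (-1 : ℝ) ^ k * n.choose k *
            ((ascPochhammer ℝ k).eval b / (ascPochhammer ℝ k).eval c) := by
        rw [Finset.sum_range_succ _ (n + 1)]; simp
      rw [hlast, Finset.sum_range_succ' _ (n + 1), Finset.sum_range_succ' _ (n + 1),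
        Finset.mul_sum, add_sub_right_comm, ← Finset.sum_sub_distrib]
      congr 1
      · refine Finset.sum_congr rfl fun k _ => ?_
        rw [Nat.choose_succ_succ, Real.ascPochhammer_succ_eval_left, Real.ascPochhammer_succ_eval_left,
          mul_div_mul_comm]
        push_cast
        ring
      · simp
    rw [hstep, ih b c hc, ih (b + 1) (c + 1) (by linarith)]
    have h1 := Real.ascPochhammer_succ_eval_left n c
    have h2 := ascPochhammer_succ_eval n c
    have h3 := (ascPochhammer_pos n c hc).ne'
    have h4 := (ascPochhammer_pos n (c + 1) (by linarith)).ne'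
    have h5 : c + n ≠ 0 := by positivity
    have h6 : (ascPochhammer ℝ n).eval (c + 1) = (ascPochhammer ℝ n).eval c * (c + n) / c := by
      rw [eq_div_iff hc.ne', ← h2, h1]; ring
    rw [h6, h2, ascPochhammer_succ_eval, show c + 1 - (b + 1) = c - b by ring]
    field_simp
    ring

theorem integral_rpow_mul_one_sub_rpow {a b : ℝ} (ha : 0 < a) (hb : 0 < b) :
    ∫ t in (0 : ℝ)..1, t ^ (a - 1) * (1 - t) ^ (b - 1)
      = Real.Gamma a * Real.Gamma b / Real.Gamma (a + b) := by
  have h := Complex.betaIntegral_eq_Gamma_mul_div (a : ℂ) b (by simpa) (by simpa)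
  have h2 : Complex.betaIntegral a b
      = ((∫ t in (0 : ℝ)..1, t ^ (a - 1) * (1 - t) ^ (b - 1) : ℝ) : ℂ) := by
    rw [Complex.betaIntegral, ← intervalIntegral.integral_ofReal]
    refine intervalIntegral.integral_congr fun t ht => ?_
    rw [Set.uIcc_of_le zero_le_one] at ht
    have h1 : (0 : ℝ) ≤ 1 - t := by linarith [ht.2]
    push_cast [Complex.ofReal_cpow ht.1, Complex.ofReal_cpow h1]
    rfl
  rw [h2, ← Complex.ofReal_add, Complex.Gamma_ofReal, Complex.Gamma_ofReal,
    Complex.Gamma_ofReal] at h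
  exact_mod_cast h

theorem intervalIntegrable_rpow_mul_one_sub_rpow {a b : ℝ} (ha : 0 < a) (hb : 0 < b) :
    IntervalIntegrable (fun t : ℝ => t ^ (a - 1) * (1 - t) ^ (b - 1)) volume 0 1 := by
  by_contra h
  have h1 := integral_rpow_mul_one_sub_rpow ha hb
  rw [intervalIntegral.integral_undef h] at h1
  have := Real.Gamma_pos_of_pos ha
  have := Real.Gamma_pos_of_pos hb
  have := Real.Gamma_pos_of_pos (add_pos ha hb)
  have : 0 < Real.Gamma a * Real.Gamma b / Real.Gamma (a + b) := by positivity
  linarith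

/-- The Jacobi weight. -/
noncomputable def jacobiWeight (α β x : ℝ) : ℝ := (1 - x) ^ α * (1 + x) ^ β

theorem jacobiWeight_affine (α β t : ℝ) (ht : t ∈ Set.Icc (0 : ℝ) 1) :
    jacobiWeight α β (2 * t + -1) = 2 ^ (α + β) * (t ^ β * (1 - t) ^ α) := by
  rw [jacobiWeight, show 1 - (2 * t + -1) = 2 * (1 - t) by ring,
    show 1 + (2 * t + -1) = 2 * t by ring,
    Real.mul_rpow zero_le_two (by linarith [ht.2]), Real.mul_rpow zero_le_two ht.1,
    Real.rpow_add zero_lt_two]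
  ring

theorem integral_jacobiWeight {α β : ℝ} (hα : -1 < α) (hβ : -1 < β) :
    ∫ x in (-1 : ℝ)..1, jacobiWeight α β x
      = 2 ^ (α + β + 1) *
        (Real.Gamma (β + 1) * Real.Gamma (α + 1) / Real.Gamma (β + 1 + (α + 1))) := by
  have h1 : (2 : ℝ) * ∫ t in (0 : ℝ)..1, jacobiWeight α β (2 * t + -1)
      = ∫ x in (-1 : ℝ)..1, jacobiWeight α β x := by
    rw [intervalIntegral.mul_integral_comp_mul_add]
    norm_num
  have h2 : ∫ t in (0 : ℝ)..1, jacobiWeight α β (2 * t + -1)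
      = ∫ t in (0 : ℝ)..1, 2 ^ (α + β) * (t ^ (β + 1 - 1) * (1 - t) ^ (α + 1 - 1)) := by
    refine intervalIntegral.integral_congr fun t ht => ?_
    rw [Set.uIcc_of_le zero_le_one] at ht
    simp [jacobiWeight_affine α β t ht]
  rw [← h1, h2, intervalIntegral.integral_const_mul,
    integral_rpow_mul_one_sub_rpow (by linarith) (by linarith), Real.rpow_add zero_lt_two (α + β),
    Real.rpow_one]
  ring

theorem intervalIntegrable_jacobiWeight {α β : ℝ} (hα : -1 < α) (hβ : -1 < β) :
    IntervalIntegrable (jacobiWeight α β) volume (-1) 1 := by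
  by_contra h
  have h1 := integral_jacobiWeight hα hβ
  rw [intervalIntegral.integral_undef h] at h1
  have := Real.Gamma_pos_of_pos (show 0 < α + 1 by linarith)
  have := Real.Gamma_pos_of_pos (show 0 < β + 1 by linarith)
  have := Real.Gamma_pos_of_pos (show 0 < β + 1 + (α + 1) by linarith)
  have : 0 < (2 : ℝ) ^ (α + β + 1) * (Real.Gamma (β + 1) * Real.Gamma (α + 1) /
    Real.Gamma (β + 1 + (α + 1))) := by positivity
  linarith

theorem intervalIntegrable_eval_mul_jacobiWeight {α β : ℝ} (hα : -1 < α) (hβ : -1 < β)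
    (p : ℝ[X]) :
    IntervalIntegrable (fun x => p.eval x * jacobiWeight α β x) volume (-1) 1 :=
  (intervalIntegrable_jacobiWeight hα hβ).continuousOn_mul p.continuous.continuousOn

/-- Integration of polynomials against the Jacobi weight. -/
noncomputable def jacobiFunctional {α β : ℝ} (hα : -1 < α) (hβ : -1 < β) : ℝ[X] →ₗ[ℝ] ℝ where
  toFun p := ∫ x in (-1 : ℝ)..1, p.eval x * jacobiWeight α β x
  map_add' p q := by
    simp only [eval_add, add_mul]
    exact intervalIntegral.integral_add (intervalIntegrable_eval_mul_jacobiWeight hα hβ p)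
      (intervalIntegrable_eval_mul_jacobiWeight hα hβ q)
  map_smul' c p := by
    simp [mul_assoc]

theorem jacobiFunctional_eq {α β : ℝ} (hα : -1 < α) (hβ : -1 < β) (p : ℝ[X]) :
    jacobiFunctional hα hβ p
      = ∫ x in Set.Ioo (-1 : ℝ) 1, p.eval x * (1 - x) ^ α * (1 + x) ^ β := by
  change ∫ x in (-1 : ℝ)..1, p.eval x * jacobiWeight α β x = _
  rw [intervalIntegral.integral_of_le (by norm_num), integral_Ioc_eq_integral_Ioo]
  simp only [jacobiWeight, mul_assoc]

theorem jacobiFunctional_monomials {α β : ℝ} (hα : -1 < α) (hβ : -1 < β) (k j : ℕ) :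
    jacobiFunctional hα hβ ((1 + X) ^ k * (1 - X) ^ j)
      = 2 ^ (α + β + 1) * 2 ^ (k + j) *
        (Real.Gamma (β + 1 + k) * Real.Gamma (α + 1 + j) / Real.Gamma (α + β + 2 + j + k)) := by
  have hk : (0 : ℝ) ≤ k := k.cast_nonneg
  have hj : (0 : ℝ) ≤ j := j.cast_nonneg
  have h := integral_jacobiWeight (α := α + j) (β := β + k) (by linarith) (by linarith)
  have h2 : jacobiFunctional hα hβ ((1 + X) ^ k * (1 - X) ^ j)
      = ∫ x in (-1 : ℝ)..1, jacobiWeight (α + j) (β + k) x := by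
    rw [jacobiFunctional_eq, intervalIntegral.integral_of_le (by norm_num),
      integral_Ioc_eq_integral_Ioo]
    refine setIntegral_congr_fun measurableSet_Ioo fun x hx => ?_
    have h1 : 0 < 1 - x := by linarith [hx.2]
    have h3 : 0 < 1 + x := by linarith [hx.1]
    simp only [jacobiWeight, eval_mul, eval_pow, eval_add, eval_sub, eval_one, eval_X,
      Real.rpow_add h1, Real.rpow_add h3, Real.rpow_natCast]
    ring
  rw [h2, h, show α + j + (β + k) + 1 = α + β + 1 + ((k + j : ℕ) : ℝ) by push_cast; ring,
    Real.rpow_add zero_lt_two, Real.rpow_natCast, add_right_comm β, add_right_comm α (j : ℝ),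
    show β + 1 + k + (α + 1 + j) = α + β + 2 + j + k by ring]

theorem jacobiFunctional_sq_pos {α β : ℝ} (hα : -1 < α) (hβ : -1 < β) {p : ℝ[X]} (hp : p ≠ 0) :
    0 < jacobiFunctional hα hβ (p ^ 2) := by
  change 0 < ∫ x in (-1 : ℝ)..1, (p ^ 2).eval x * jacobiWeight α β x
  have hw : ∀ x ∈ Set.Ioo (-1 : ℝ) 1, 0 < jacobiWeight α β x := fun x hx =>
    mul_pos (Real.rpow_pos_of_pos (by linarith [hx.2]) _)
      (Real.rpow_pos_of_pos (by linarith [hx.1]) _)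
  have hint := intervalIntegrable_eval_mul_jacobiWeight hα hβ (p ^ 2)
  rw [intervalIntegrable_iff_integrableOn_Ioo_of_le (by norm_num)] at hint
  rw [intervalIntegral.integral_of_le (by norm_num), integral_Ioc_eq_integral_Ioo,
    setIntegral_pos_iff_support_of_nonneg_ae _ hint]
  · have hsub : Set.Ioo (-1 : ℝ) 1 \ (p.roots.toFinset : Set ℝ) ⊆
        (Function.support fun x => (p ^ 2).eval x * jacobiWeight α β x) ∩ Set.Ioo (-1) 1 := by
      intro x hx
      refine ⟨?_, hx.1⟩
      have hx2 : p.eval x ≠ 0 := by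
        intro h0
        exact hx.2 (by simpa [hp] using h0)
      have := hw x hx.1
      simp only [Function.mem_support, eval_pow]
      positivity
    refine lt_of_lt_of_le ?_ (measure_mono hsub)
    rw [measure_sdiff_null (Finset.measure_zero _ _)]
    simp
  · filter_upwards [ae_restrict_mem measurableSet_Ioo] with x hx
    have := hw x hx
    simp only [Pi.zero_apply, eval_pow]
    positivity

/-- The Jacobi polynomial normalized to take the value `1` at `-1`. -/
noncomputable def jacobiLeft (α β : ℝ) (n : ℕ) : ℝ[X] :=
  ∑ k ∈ Finset.range (n + 1),
    C ((-1) ^ k * n.choose k * ((ascPochhammer ℝ k).eval (n + α + β + 1) /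
      (ascPochhammer ℝ k).eval (β + 1)) / 2 ^ k) * (1 + X) ^ k

theorem jacobiLeft_eval_neg_one (α β : ℝ) (n : ℕ) : (jacobiLeft α β n).eval (-1) = 1 := by
  rw [jacobiLeft, eval_finsetSum, Finset.sum_range_succ']
  simp

theorem jacobiLeft_derivative_eval_neg_one (α β : ℝ) (n : ℕ) :
    (derivative (jacobiLeft α β n)).eval (-1) = -(n * (n + α + β + 1) / (2 * (β + 1))) := by
  rw [jacobiLeft, derivative_sum, eval_finsetSum]
  rcases n with _ | n
  · simp
  rw [Finset.sum_range_succ', Finset.sum_range_succ']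
  simp only [derivative_mul, derivative_C, derivative_pow, eval_mul, eval_add, eval_pow]
  simp
  field_simp
  ring

theorem jacobiLeft_coeff (α β : ℝ) (n m : ℕ) (hm : n ≤ m) :
    (jacobiLeft α β n).coeff m = if m = n then (-1) ^ n * ((ascPochhammer ℝ n).eval (n + α + β + 1) /
      (ascPochhammer ℝ n).eval (β + 1)) / 2 ^ n else 0 := by
  simp only [jacobiLeft, finsetSum_coeff, coeff_C_mul, coeff_one_add_X_pow]
  rw [Finset.sum_range_succ, Finset.sum_eq_zero]
  · split_ifs with h
    · simp [h]
    · rw [Nat.choose_eq_zero_of_lt (lt_of_le_of_ne hm (Ne.symm h))]; simp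
  · intro k hk
    rw [Finset.mem_range] at hk
    rw [Nat.choose_eq_zero_of_lt (by omega : k < m)]; simp

theorem jacobiFunctional_jacobiLeft_mul {α β : ℝ} (hα : -1 < α) (hβ : -1 < β) (n j : ℕ) :
    jacobiFunctional hα hβ (jacobiLeft α β n * (1 - X) ^ j)
      = 2 ^ (α + β + 1) * 2 ^ j * Real.Gamma (β + 1) * Real.Gamma (α + 1 + j)
        / Real.Gamma (α + β + 2 + j)
        * ((ascPochhammer ℝ n).eval (j + 1 - n : ℝ)
          / (ascPochhammer ℝ n).eval (α + β + 2 + j)) := by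
  have hj : (0 : ℝ) ≤ j := j.cast_nonneg
  have hb : 0 < β + 1 := by linarith
  have hc : 0 < α + β + 2 + j := by linarith
  rw [show (j + 1 - n : ℝ) = α + β + 2 + j - (n + α + β + 1) by ring,
    ← sum_choose_mul_ascPochhammer_div n _ _ hc, jacobiLeft, Finset.sum_mul, map_sum,
    Finset.mul_sum]
  refine Finset.sum_congr rfl fun k _ => ?_
  rw [mul_assoc, ← smul_eq_C_mul, map_smul, jacobiFunctional_monomials, Real.Gamma_add_natCast hb,
    Real.Gamma_add_natCast hc, smul_eq_mul]
  have h1 := (ascPochhammer_pos k _ hb).ne'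
  have h2 := (ascPochhammer_pos k _ hc).ne'
  have h3 := (Real.Gamma_pos_of_pos hc).ne'
  field_simp
  ring

theorem jacobiFunctional_jacobiLeft_mul_of_lt {α β : ℝ} (hα : -1 < α) (hβ : -1 < β) {n j : ℕ}
    (hj : j < n) : jacobiFunctional hα hβ (jacobiLeft α β n * (1 - X) ^ j) = 0 := by
  rw [jacobiFunctional_jacobiLeft_mul]
  have h : (j + 1 - n : ℝ) = -((n - 1 - j : ℕ) : ℝ) := by
    rw [Nat.cast_sub (by omega), Nat.cast_sub (by omega)]; push_cast; ring
  rw [h, ascPochhammer_eval_neg_coe_nat_of_lt (by omega)]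
  simp

theorem jacobiFunctional_jacobiLeft_mul_of_degree_lt {α β : ℝ} (hα : -1 < α) (hβ : -1 < β) {n : ℕ}
    {p : ℝ[X]} (hp : p.degree < n) : jacobiFunctional hα hβ (jacobiLeft α β n * p) = 0 := by
  rw [← sum_taylor_eq p 1, Polynomial.sum, Finset.mul_sum, map_sum]
  refine Finset.sum_eq_zero fun j hj => ?_
  have hjn : j < n := by
    have h1 := le_degree_of_mem_supp j hj
    rw [degree_taylor] at h1
    exact_mod_cast h1.trans_lt hp
  have h2 : jacobiLeft α β n * (C ((taylor 1 p).coeff j) * (X - C 1) ^ j)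
      = ((taylor 1 p).coeff j * (-1) ^ j) • (jacobiLeft α β n * (1 - X) ^ j) := by
    rw [smul_eq_C_mul, C_mul, C_pow, show (X - C 1 : ℝ[X]) = C (-1) * (1 - X) by simp, mul_pow]
    ring
  rw [h2, map_smul, jacobiFunctional_jacobiLeft_mul_of_lt hα hβ hjn, smul_zero]

theorem jacobiFunctional_jacobiLeft_sq {α β : ℝ} (hα : -1 < α) (hβ : -1 < β) {n : ℕ}
    (hn : 1 ≤ n) :
    jacobiFunctional hα hβ (jacobiLeft α β n ^ 2)
      = 2 ^ (α + β + 1) * Real.Gamma (β + 1) ^ 2 * (n.factorial * Real.Gamma (α + 1 + n))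
        * (n + α + β + 1)
        / (Real.Gamma (β + 1 + n) * Real.Gamma (n + α + β + 2) * (2 * n + α + β + 1)) := by
  have hn' : (1 : ℝ) ≤ n := by exact_mod_cast hn
  have hb : 0 < β + 1 := by linarith
  have hs : 0 < n + α + β + 1 := by linarith
  set a : ℝ := (ascPochhammer ℝ n).eval (n + α + β + 1) / (ascPochhammer ℝ n).eval (β + 1) / 2 ^ n
    with ha
  have hdeg : (jacobiLeft α β n - C a * (1 - X) ^ n).degree < (n : WithBot ℕ) := by
    rw [degree_lt_iff_coeff_zero]
    intro m hm
    have h1 : ((1 - X : ℝ[X]) ^ n) = C ((-1) ^ n) * (X - C 1) ^ n := by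
      rw [C_pow, ← mul_pow]; simp
    have hmon : ((X - C (1 : ℝ)) ^ n).Monic := (monic_X_sub_C 1).pow n
    have hnd : ((X - C (1 : ℝ)) ^ n).natDegree = n := by
      rw [natDegree_pow, natDegree_X_sub_C, mul_one]
    rw [coeff_sub, jacobiLeft_coeff _ _ _ _ hm, h1, coeff_C_mul, coeff_C_mul]
    split_ifs with h
    · subst h
      have h2 := hmon.coeff_natDegree
      rw [hnd] at h2
      rw [h2]
      ring
    · rw [coeff_eq_zero_of_natDegree_lt (by rw [hnd]; omega)]
      simp
  have h0 := jacobiFunctional_jacobiLeft_mul_of_degree_lt hα hβ hdeg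
  have h1 : jacobiLeft α β n ^ 2 = jacobiLeft α β n * (jacobiLeft α β n - C a * (1 - X) ^ n)
      + a • (jacobiLeft α β n * (1 - X) ^ n) := by
    rw [smul_eq_C_mul]; ring
  rw [h1, map_add, h0, map_smul, jacobiFunctional_jacobiLeft_mul, Real.Gamma_add_natCast hb,
    show (n + 1 - n : ℝ) = 1 by ring, ascPochhammer_eval_one,
    show α + β + 2 + n = n + α + β + 1 + 1 by ring, show n + α + β + 2 = n + α + β + 1 + 1 by ring]
  have h3 := Real.ascPochhammer_succ_eval_left n (n + α + β + 1)
  rw [ascPochhammer_succ_eval] at h3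
  have h4 := ascPochhammer_pos n _ hb
  have h5 := ascPochhammer_pos n (n + α + β + 1 + 1) (by linarith)
  have h6 := Real.Gamma_pos_of_pos (show 0 < n + α + β + 1 + 1 by linarith)
  have h7 := Real.Gamma_pos_of_pos hb
  have h8 : 2 * n + α + β + 1 ≠ 0 := by linarith
  have h9 : (ascPochhammer ℝ n).eval (n + α + β + 1) = (n + α + β + 1) *
      (ascPochhammer ℝ n).eval (n + α + β + 1 + 1) / (2 * n + α + β + 1) := by
    rw [eq_div_iff h8, ← h3]; ring
  rw [ha, h9, smul_eq_mul]
  generalize (ascPochhammer ℝ n).eval (n + α + β + 1 + 1) = A at *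
  generalize Real.Gamma (n + α + β + 1 + 1) = B at *
  generalize (ascPochhammer ℝ n).eval (β + 1) = D at *
  field_simp
  ring

theorem jacobiLeft_ne_zero (α β : ℝ) (n : ℕ) : jacobiLeft α β n ≠ 0 := by
  intro h
  simpa [h] using jacobiLeft_eval_neg_one α β n

theorem exists_eq_C_mul_jacobiLeft {α β : ℝ} (hα : -1 < α) (hβ : -1 < β) {n : ℕ} (hn : 1 ≤ n)
    {p : ℝ[X]} (hdeg : p.natDegree = n) (hp : p ≠ 0)
    (horth : ∀ k < n, jacobiFunctional hα hβ (p * X ^ k) = 0) :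
    ∃ c : ℝ, c ≠ 0 ∧ p = C c * jacobiLeft α β n := by
  have hn' : (1 : ℝ) ≤ n := by exact_mod_cast hn
  have hlead : (jacobiLeft α β n).coeff n ≠ 0 := by
    rw [jacobiLeft_coeff _ _ _ _ le_rfl, if_pos rfl]
    have h1 := ascPochhammer_pos n (n + α + β + 1) (by linarith)
    have h2 := ascPochhammer_pos n (β + 1) (by linarith)
    have h3 : ((-1 : ℝ) ^ n) ≠ 0 := by simp
    positivity
  have hplead : p.coeff n ≠ 0 := by
    rw [← hdeg]; exact leadingCoeff_ne_zero.mpr hp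
  refine ⟨p.coeff n / (jacobiLeft α β n).coeff n, div_ne_zero hplead hlead, ?_⟩
  set c := p.coeff n / (jacobiLeft α β n).coeff n with hc
  set r := p - C c * jacobiLeft α β n with hr
  have hrdeg : r.degree < n := by
    rw [degree_lt_iff_coeff_zero]
    intro m hm
    rw [hr, coeff_sub, coeff_C_mul]
    rcases hm.eq_or_lt with rfl | h
    · rw [hc]; field_simp; ring
    · rw [coeff_eq_zero_of_natDegree_lt (by omega), jacobiLeft_coeff _ _ _ _ hm,
        if_neg (by omega)]
      simp
  have hpr : jacobiFunctional hα hβ (p * r) = 0 := by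
    rw [r.as_sum_support_C_mul_X_pow, Finset.mul_sum, map_sum]
    refine Finset.sum_eq_zero fun k hk => ?_
    have hkn : k < n := by exact_mod_cast (le_degree_of_mem_supp k hk).trans_lt hrdeg
    rw [mul_left_comm, ← smul_eq_C_mul, map_smul, horth k hkn, smul_zero]
  have hsq : jacobiFunctional hα hβ (r ^ 2) = 0 := by
    have : r ^ 2 = p * r - c • (jacobiLeft α β n * r) := by
      rw [smul_eq_C_mul, sq]
      nth_rewrite 1 [hr]
      ring
    rw [this, map_sub, map_smul, hpr, jacobiFunctional_jacobiLeft_mul_of_degree_lt hα hβ hrdeg]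
    simp
  by_contra hne
  have := jacobiFunctional_sq_pos hα hβ (p := r) (sub_ne_zero.mpr hne)
  linarith

theorem Real.ascPochhammer_eval_eq_prod (n : ℕ) (a : ℝ) :
    (ascPochhammer ℝ n).eval a = ∏ j ∈ Finset.range n, (a + j) := by
  induction n with
  | zero => simp
  | succ n ih => rw [ascPochhammer_succ_eval, ih, Finset.prod_range_succ]

theorem Real.tendsto_Gamma_add_natCast_div {a : ℝ} (ha : 0 < a) :
    Tendsto (fun n : ℕ => Real.Gamma (a + n) / (n.factorial * (n : ℝ) ^ (a - 1))) atTop (nhds 1) := by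
  have hG := (Real.Gamma_pos_of_pos ha).ne'
  have h1 : Tendsto (fun n : ℕ => Real.Gamma a / Real.GammaSeq a n) atTop (nhds 1) := by
    rw [← div_self hG]
    exact tendsto_const_nhds.div (Real.GammaSeq_tendsto_Gamma a) hG
  have h2 : Tendsto (fun n : ℕ => (n : ℝ) / (n + a)) atTop (nhds 1) :=
    tendsto_natCast_div_add_atTop a
  have h3 := h1.mul h2
  rw [mul_one] at h3
  refine h3.congr' ?_
  filter_upwards [eventually_gt_atTop 0] with n hn
  have hn' : (0 : ℝ) < n := by exact_mod_cast hn
  have h4 := Real.Gamma_add_natCast ha n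
  have h5 : ∏ j ∈ Finset.range (n + 1), (a + j) = (ascPochhammer ℝ n).eval a * (a + n) := by
    rw [← ascPochhammer_succ_eval, Real.ascPochhammer_eval_eq_prod]
  have h6 := (ascPochhammer_pos n a ha).ne'
  have h7 : (n.factorial : ℝ) ≠ 0 := by positivity
  have h8 : (n : ℝ) ^ a ≠ 0 := by positivity
  have h9 : (n : ℝ) + a ≠ 0 := by positivity
  rw [Real.GammaSeq, h5, h4, Real.rpow_sub_one hn'.ne', add_comm a (n : ℝ)]
  field_simp

theorem tendsto_one_add_rpow_sub_div (p : ℝ) :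
    Tendsto (fun n : ℕ => (((n + 1 : ℕ) : ℝ) ^ (p + 1) - (n : ℝ) ^ (p + 1)) / (n : ℝ) ^ p)
      atTop (nhds (p + 1)) := by
  have hd : HasDerivAt (fun x : ℝ => x ^ (p + 1)) (p + 1) 1 := by
    simpa using Real.hasDerivAt_rpow_const (x := 1) (p := p + 1) (Or.inl one_ne_zero)
  have h1 := hd.tendsto_slope_zero_right
  have h2 : Tendsto (fun n : ℕ => ((n : ℝ))⁻¹) atTop (nhdsWithin 0 (Set.Ioi 0)) :=
    tendsto_inv_atTop_nhdsGT_zero.comp tendsto_natCast_atTop_atTop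
  refine (h1.comp h2).congr' ?_
  filter_upwards [eventually_gt_atTop 0] with n hn
  have hn' : (0 : ℝ) < n := by exact_mod_cast hn
  have h3 : ((n + 1 : ℕ) : ℝ) = n * (1 + (n : ℝ)⁻¹) := by
    push_cast; field_simp
  have h4 : (n : ℝ) ^ p ≠ 0 := by positivity
  simp only [Function.comp_apply, inv_inv, Real.one_rpow, smul_eq_mul]
  rw [h3, Real.mul_rpow hn'.le (by positivity), Real.rpow_add_one hn'.ne']
  field_simp

theorem tendsto_sum_range_div_rpow {f : ℕ → ℝ} {p b : ℝ} (hp : 0 < p + 1)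
    (hf : Tendsto (fun n : ℕ => f n / (n : ℝ) ^ p) atTop (nhds b)) :
    Tendsto (fun n : ℕ => (∑ m ∈ Finset.range n, f m) / (n : ℝ) ^ (p + 1)) atTop
      (nhds (b / (p + 1))) := by
  set g : ℕ → ℝ := fun n => ((n + 1 : ℕ) : ℝ) ^ (p + 1) - (n : ℝ) ^ (p + 1) with hg
  have hsum : ∀ n, ∑ m ∈ Finset.range n, g m = (n : ℝ) ^ (p + 1) := fun n => by
    rw [hg, Finset.sum_range_sub (fun n : ℕ => (n : ℝ) ^ (p + 1))]
    simp [Real.zero_rpow hp.ne']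
  have hg0 : 0 ≤ g := fun n => sub_nonneg.mpr
    (Real.rpow_le_rpow n.cast_nonneg (by push_cast; linarith) hp.le)
  have hratio : Tendsto (fun n => f n / g n) atTop (nhds (b / (p + 1))) := by
    refine (hf.div (tendsto_one_add_rpow_sub_div p) hp.ne').congr' ?_
    filter_upwards [eventually_gt_atTop 0] with n hn
    have hn' : (0 : ℝ) < n := by exact_mod_cast hn
    have h4 : (n : ℝ) ^ p ≠ 0 := by positivity
    exact div_div_div_cancel_right₀ h4 _ _
  have hgpos : ∀ n, 0 < g n := fun n => sub_pos.mpr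
    (Real.rpow_lt_rpow n.cast_nonneg (by push_cast; linarith) hp)
  have hlo : (fun n => f n - b / (p + 1) * g n) =o[atTop] g := by
    rw [Asymptotics.isLittleO_iff_tendsto (fun n h => absurd h (hgpos n).ne')]
    have := hratio.sub_const (b / (p + 1))
    rw [sub_self] at this
    refine this.congr fun n => ?_
    rw [sub_div, mul_div_cancel_right₀ _ (hgpos n).ne']
  have htop : Tendsto (fun n : ℕ => (n : ℝ) ^ (p + 1)) atTop atTop :=
    (tendsto_rpow_atTop hp).comp tendsto_natCast_atTop_atTop
  have hlim := (hlo.sum_range hg0 (by simpa only [hsum] using htop)).tendsto_div_nhds_zero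
  simp only [hsum, Finset.sum_sub_distrib, ← Finset.mul_sum] at hlim
  have := hlim.add_const (b / (p + 1))
  rw [zero_add] at this
  refine this.congr' ?_
  filter_upwards [eventually_gt_atTop 0] with n hn
  have hn' : (0 : ℝ) < n := by exact_mod_cast hn
  have h4 : (n : ℝ) ^ (p + 1) ≠ 0 := by positivity
  rw [sub_div, mul_div_cancel_right₀ _ h4, sub_add_cancel]

theorem tendsto_inv_jacobiFunctional_jacobiLeft_sq {α β : ℝ} (hα : -1 < α) (hβ : -1 < β) :
    Tendsto (fun n : ℕ => (jacobiFunctional hα hβ (jacobiLeft α β n ^ 2))⁻¹ / (n : ℝ) ^ (2 * β + 1))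
      atTop (nhds (2 / (2 ^ (α + β + 1) * Real.Gamma (β + 1) ^ 2))) := by
  have hb : 0 < β + 1 := by linarith
  have hs : Tendsto (fun n : ℕ => (2 * n + α + β + 1) / (n + α + β + 1 : ℝ)) atTop (nhds 2) := by
    have h := (tendsto_natCast_div_add_atTop (α + β + 1)).add_const 1
    rw [one_add_one_eq_two] at h
    refine h.congr' ?_
    filter_upwards [eventually_ge_atTop 1] with n hn
    have hn' : (1 : ℝ) ≤ n := by exact_mod_cast hn
    have h1 : n + (α + β + 1) ≠ 0 := by linarith
    have h2 : n + α + β + 1 ≠ 0 := by linarith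
    field_simp
    ring
  have h := ((((Real.tendsto_Gamma_add_natCast_div hb).mul
    (Real.tendsto_Gamma_add_natCast_div (show 0 < α + β + 2 by linarith))).div
    (Real.tendsto_Gamma_add_natCast_div (show 0 < α + 1 by linarith)) one_ne_zero).mul hs).div_const
    (2 ^ (α + β + 1) * Real.Gamma (β + 1) ^ 2)
  rw [one_mul, div_one, one_mul] at h
  refine h.congr' ?_
  filter_upwards [eventually_ge_atTop 1] with n hn
  have hn' : (1 : ℝ) ≤ n := by exact_mod_cast hn
  have hn0 : (0 : ℝ) < n := by linarith
  have e1 : (n : ℝ) ^ (β + 1 - 1) = (n : ℝ) ^ β := by congr 1; ring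
  have e2 : (n : ℝ) ^ (α + β + 2 - 1) = (n : ℝ) ^ α * (n : ℝ) ^ β * n := by
    rw [← Real.rpow_add hn0, ← Real.rpow_add_one hn0.ne']; congr 1; ring
  have e3 : (n : ℝ) ^ (α + 1 - 1) = (n : ℝ) ^ α := by congr 1; ring
  have e4 : (n : ℝ) ^ (2 * β + 1) = (n : ℝ) ^ β * (n : ℝ) ^ β * n := by
    rw [← Real.rpow_add hn0, ← Real.rpow_add_one hn0.ne']; congr 1; ring
  have p1 : (n : ℝ) ^ α ≠ 0 := by positivity
  have p2 : (n : ℝ) ^ β ≠ 0 := by positivity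
  have p3 : n + α + β + 1 ≠ 0 := by linarith
  have p4 : 2 * n + α + β + 1 ≠ 0 := by linarith
  have p5 := (Real.Gamma_pos_of_pos hb).ne'
  have p6 := (Real.Gamma_pos_of_pos (show 0 < β + 1 + n by linarith)).ne'
  have p7 := (Real.Gamma_pos_of_pos (show 0 < α + 1 + n by linarith)).ne'
  have p8 := (Real.Gamma_pos_of_pos (show 0 < n + α + β + 2 by linarith)).ne'
  have p9 : (n.factorial : ℝ) ≠ 0 := by positivity
  have p10 : (2 : ℝ) ^ (α + β + 1) ≠ 0 := by positivity
  simp only [Pi.div_apply]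
  rw [jacobiFunctional_jacobiLeft_sq hα hβ hn, e1, e2, e3, e4,
    show α + β + 2 + n = n + α + β + 2 by ring]
  generalize (n : ℝ) ^ α = A at *
  generalize (n : ℝ) ^ β = B at *
  generalize (2 : ℝ) ^ (α + β + 1) = D at *
  field_simp

theorem tendsto_jacobiLeft_derivative_eval_div {α β : ℝ} :
    Tendsto (fun n : ℕ => (derivative (jacobiLeft α β n)).eval (-1) / (n : ℝ) ^ 2) atTop
      (nhds (-(1 / (2 * (β + 1))))) := by
  have h1 := tendsto_one_div_atTop_nhds_zero_nat (𝕜 := ℝ)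
  have h := (((h1.const_mul (α + β + 1)).const_add 1).div_const (2 * (β + 1))).neg
  rw [mul_zero, add_zero] at h
  refine h.congr' ?_
  filter_upwards [eventually_gt_atTop 0] with n hn
  have hn' : (0 : ℝ) < n := by exact_mod_cast hn
  rw [jacobiLeft_derivative_eval_neg_one]
  field_simp
  ring

theorem determinant_factor_asymptotics
    (α β : ℝ) (hα : -1 < α) (hβ : -1 < β) (M N : ℝ) (hM : 0 < M) (hN : 0 < N)
    (Pt : ℕ → ℝ[X])
    (hdeg : ∀ n, (Pt n).natDegree = n)
    (hone : ∀ n, (Pt n).eval 1 = 1)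
    (horth : ∀ n k, k < n →
      ∫ x in Set.Ioo (-1 : ℝ) 1, (Pt n).eval x * x ^ k * (1 - x) ^ α * (1 + x) ^ β = 0)
    (Kd : ℕ → ℕ → ℕ → ℝ)
    (hKd : ∀ i j n, Kd i j n
      = ∑ m ∈ Finset.range n,
          ((⇑(derivative (R := ℝ)))^[i] (Pt m)).eval (-1)
            * ((⇑(derivative (R := ℝ)))^[j] (Pt m)).eval (-1)
            / ∫ x in Set.Ioo (-1 : ℝ) 1, ((Pt m).eval x) ^ 2 * (1 - x) ^ α * (1 + x) ^ β)
    : Tendsto (fun n : ℕ =>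
        ((1 + M * Kd 0 0 n) * (1 + N * Kd 1 1 n) - M * N * (Kd 1 0 n) ^ 2)
          / (n : ℝ) ^ (4 * β + 8))
      atTop
      (nhds (M * N
        / ((2 : ℝ) ^ (2 * α + 2 * β + 4) * (β + 1) * (β + 2) ^ 2 * (β + 3)
            * (Real.Gamma (β + 1)) ^ 2 * (Real.Gamma (β + 2)) ^ 2))) := by
  have hb : 0 < β + 1 := by linarith
  set d : ℕ → ℝ := fun n => (derivative (jacobiLeft α β n)).eval (-1) with hd
  set u : ℕ → ℝ := fun n => (jacobiFunctional hα hβ (jacobiLeft α β n ^ 2))⁻¹ with hu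
  set c : ℝ := 2 / (2 ^ (α + β + 1) * Real.Gamma (β + 1) ^ 2) with hc
  set r : ℝ := -(1 / (2 * (β + 1))) with hr
  have hulim : Tendsto (fun n : ℕ => u n / (n : ℝ) ^ (2 * β + 1)) atTop (nhds c) :=
    tendsto_inv_jacobiFunctional_jacobiLeft_sq hα hβ
  have hdlim : Tendsto (fun n : ℕ => d n / (n : ℝ) ^ 2) atTop (nhds r) :=
    tendsto_jacobiLeft_derivative_eval_div
  have hrep : ∀ n, 1 ≤ n → ∃ a : ℝ, a ≠ 0 ∧ Pt n = C a * jacobiLeft α β n := by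
    intro n hn
    refine exists_eq_C_mul_jacobiLeft hα hβ hn (hdeg n) ?_ fun k hk => ?_
    · intro h0
      simpa [h0] using hone n
    · rw [jacobiFunctional_eq]
      simpa using horth n k hk
  have hterm : ∀ i j n, 1 ≤ n → ((⇑(derivative (R := ℝ)))^[i] (Pt n)).eval (-1)
      * ((⇑(derivative (R := ℝ)))^[j] (Pt n)).eval (-1)
      / (∫ x in Set.Ioo (-1 : ℝ) 1, ((Pt n).eval x) ^ 2 * (1 - x) ^ α * (1 + x) ^ β)
      = ((⇑(derivative (R := ℝ)))^[i] (jacobiLeft α β n)).eval (-1)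
      * ((⇑(derivative (R := ℝ)))^[j] (jacobiLeft α β n)).eval (-1) * u n := by
    intro i j n hn
    obtain ⟨a, ha, hP⟩ := hrep n hn
    have h1 : ∫ x in Set.Ioo (-1 : ℝ) 1, ((Pt n).eval x) ^ 2 * (1 - x) ^ α * (1 + x) ^ β
        = a ^ 2 * jacobiFunctional hα hβ (jacobiLeft α β n ^ 2) := by
      rw [← smul_eq_mul, ← map_smul, jacobiFunctional_eq, hP]
      simp [mul_pow]
    have h2 := (jacobiFunctional_sq_pos hα hβ (jacobiLeft_ne_zero α β n)).ne'
    rw [h1, hP, iterate_derivative_C_mul, iterate_derivative_C_mul, eval_C_mul, eval_C_mul, hu]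
    field_simp
  have hK : ∀ (i j : ℕ) (p b : ℝ), 0 < p + 1 →
      Tendsto (fun n : ℕ => ((⇑(derivative (R := ℝ)))^[i] (jacobiLeft α β n)).eval (-1)
        * ((⇑(derivative (R := ℝ)))^[j] (jacobiLeft α β n)).eval (-1) * u n / (n : ℝ) ^ p)
        atTop (nhds b) →
      Tendsto (fun n : ℕ => Kd i j n / (n : ℝ) ^ (p + 1)) atTop (nhds (b / (p + 1))) := by
    intro i j p b hp h
    simp only [hKd]
    refine tendsto_sum_range_div_rpow hp (h.congr' ?_)
    filter_upwards [eventually_ge_atTop 1] with n hn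
    rw [hterm i j n hn]
  have h00 := hK 0 0 (2 * β + 1) c (by linarith) (by
    simpa [jacobiLeft_eval_neg_one] using hulim)
  have h10 := hK 1 0 (2 * β + 3) (r * c) (by linarith) (by
    refine (hdlim.mul hulim).congr' ?_
    filter_upwards [eventually_gt_atTop 0] with n hn
    have hn' : (0 : ℝ) < n := by exact_mod_cast hn
    have e : (n : ℝ) ^ (2 * β + 3) = n ^ 2 * (n : ℝ) ^ (2 * β + 1) := by
      rw [mul_comm ((n : ℝ) ^ 2), ← Real.rpow_add_natCast hn'.ne']; congr 1; push_cast; ring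
    rw [e, ← mul_div_mul_comm]
    simp [jacobiLeft_eval_neg_one, hd])
  have h11 := hK 1 1 (2 * β + 5) (r * (r * c)) (by linarith) (by
    refine (hdlim.mul (hdlim.mul hulim)).congr' ?_
    filter_upwards [eventually_gt_atTop 0] with n hn
    have hn' : (0 : ℝ) < n := by exact_mod_cast hn
    have e : (n : ℝ) ^ (2 * β + 5) = n ^ 2 * (n ^ 2 * (n : ℝ) ^ (2 * β + 1)) := by
      rw [← mul_assoc, ← pow_add, mul_comm ((n : ℝ) ^ (2 + 2)), ← Real.rpow_add_natCast hn'.ne']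
      congr 1; push_cast; ring
    rw [e, ← mul_div_mul_comm, ← mul_div_mul_comm]
    simp [hd, mul_assoc])
  have hone_div : ∀ p : ℝ, 0 < p →
      Tendsto (fun n : ℕ => 1 / (n : ℝ) ^ p) atTop (nhds 0) := fun p hp => by
    simp only [one_div]
    exact ((tendsto_rpow_atTop hp).comp tendsto_natCast_atTop_atTop).inv_tendsto_atTop
  have hlim := (((hone_div (2 * β + 1 + 1) (by linarith)).add (h00.const_mul M)).mul
    ((hone_div (2 * β + 5 + 1) (by linarith)).add (h11.const_mul N))).sub
    ((h10.pow 2).const_mul (M * N))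
  convert hlim.congr' ?_ using 2
  · have hG : Real.Gamma (β + 2) = (β + 1) * Real.Gamma (β + 1) := by
      rw [← Real.Gamma_add_one hb.ne']; congr 1; ring
    have hpow : (2 : ℝ) ^ (2 * α + 2 * β + 4) = 4 * (2 ^ (α + β + 1)) ^ 2 := by
      rw [show 2 * α + 2 * β + 4 = 2 + (α + β + 1) + (α + β + 1) by ring,
        Real.rpow_add zero_lt_two, Real.rpow_add zero_lt_two]
      norm_num
      ring
    have q1 := (Real.Gamma_pos_of_pos hb).ne'
    have q2 : (2 : ℝ) ^ (α + β + 1) ≠ 0 := by positivity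
    have q3 : β + 2 ≠ 0 := by linarith
    have q4 : β + 3 ≠ 0 := by linarith
    rw [hG, hpow, hc, hr, show 2 * β + 1 + 1 = 2 * (β + 1) by ring,
      show 2 * β + 3 + 1 = 2 * (β + 2) by ring, show 2 * β + 5 + 1 = 2 * (β + 3) by ring]
    generalize (2 : ℝ) ^ (α + β + 1) = D at *
    generalize Real.Gamma (β + 1) = G at *
    field_simp
    ring
  · filter_upwards [eventually_gt_atTop 0] with n hn
    have hn' : (0 : ℝ) < n := by exact_mod_cast hn
    have e1 : (n : ℝ) ^ (2 * β + 1 + 1) = (n : ℝ) ^ (2 * β) * n ^ 2 := by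
      rw [← Real.rpow_add_natCast hn'.ne']; congr 1; push_cast; ring
    have e2 : (n : ℝ) ^ (2 * β + 3 + 1) = (n : ℝ) ^ (2 * β) * n ^ 4 := by
      rw [← Real.rpow_add_natCast hn'.ne']; congr 1; push_cast; ring
    have e3 : (n : ℝ) ^ (2 * β + 5 + 1) = (n : ℝ) ^ (2 * β) * n ^ 6 := by
      rw [← Real.rpow_add_natCast hn'.ne']; congr 1; push_cast; ring
    have e4 : (n : ℝ) ^ (4 * β + 8) = (n : ℝ) ^ (2 * β) * (n : ℝ) ^ (2 * β) * n ^ 8 := by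
      rw [← Real.rpow_add hn', ← Real.rpow_add_natCast hn'.ne']; congr 1; push_cast; ring
    have q : (n : ℝ) ^ (2 * β) ≠ 0 := by positivity
    rw [e1, e2, e3, e4]
    generalize (n : ℝ) ^ (2 * β) = D at *
    field_simp
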